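/- arXiv:2210.07948 — 2 statements merged into one kernel-verified Lean document; each statement's English description precedes it below -/
import Mathlib

section
/- The map ψ : P → K defined by ψ(g) = g and ψ(b) = ((maxᵢ bᵢ − minᵢ bᵢ)/(1 − n·minᵢ bᵢ))·(b − g) + g for b ∈ P with b ≠ g, is well defined (its values lie in K) and bijective, and its inverse ψ⁻¹ : K → P is given by ψ⁻¹(g) = g and ψ⁻¹(b') = ((1 − n·minᵢ b'ᵢ)/(maxᵢ b'ᵢ − minᵢ b'ᵢ))·(b' − g) + g for b' ∈ K with b' ≠ g. -/
noncomputable section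

/-- The all-ones vector `u = (1,…,1)` in `ℝⁿ`. -/
def uvec (n : ℕ) : Fin n → ℝ := fun _ => 1

/-- The point `g = (1/n)·u`. -/
def gpt (n : ℕ) : Fin n → ℝ := fun _ => 1 / (n : ℝ)

/-- The cube `H = [0,1]ⁿ`. -/
def Hset (n : ℕ) : Set (Fin n → ℝ) := {x | ∀ i, 0 ≤ x i ∧ x i ≤ 1}

/-- `F = {x ∈ H : xᵢ = 1 for some i}`. -/
def Fset (n : ℕ) : Set (Fin n → ℝ) := {x ∈ Hset n | ∃ i, x i = 1}

/-- `K = {x ∈ H : x₁ + ⋯ + xₙ = 1}`. -/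
def Kset (n : ℕ) : Set (Fin n → ℝ) := {x ∈ Hset n | ∑ i, x i = 1}

/-- `Ψ₀(a) = a + (1/n)(1 − (a₁ + ⋯ + aₙ))·u`, the orthogonal projection onto the
hyperplane `Π = {x : x₁ + ⋯ + xₙ = 1}`. -/
def Psi0 (n : ℕ) (a : Fin n → ℝ) : Fin n → ℝ := a + ((1 - ∑ i, a i) / (n : ℝ)) • uvec n

/-- `P = Ψ₀(H)`. -/
def Pset (n : ℕ) : Set (Fin n → ℝ) := Psi0 n '' Hset n

open scoped Classical in
/-- `ψ(b) = ((maxᵢ bᵢ − minᵢ bᵢ)/(1 − n·minᵢ bᵢ))·(b − g) + g` for `b ≠ g`, `ψ(g) = g`. -/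
def psiMap (n : ℕ) (b : Fin n → ℝ) : Fin n → ℝ :=
  if b = gpt n then gpt n
  else (((⨆ i, b i) - ⨅ i, b i) / (1 - (n : ℝ) * ⨅ i, b i)) • (b - gpt n) + gpt n

open scoped Classical in
/-- `ψ⁻¹(b') = ((1 − n·minᵢ b'ᵢ)/(maxᵢ b'ᵢ − minᵢ b'ᵢ))·(b' − g) + g` for `b' ≠ g`,
`ψ⁻¹(g) = g`. -/
def psiInv (n : ℕ) (b : Fin n → ℝ) : Fin n → ℝ :=
  if b = gpt n then gpt n
  else ((1 - (n : ℝ) * ⨅ i, b i) / ((⨆ i, b i) - ⨅ i, b i)) • (b - gpt n) + gpt n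

/-- The homothety with centre `g` and ratio `t`. -/
def gScale (n : ℕ) (t : ℝ) (b : Fin n → ℝ) : Fin n → ℝ := t • (b - gpt n) + gpt n

lemma gScale_apply (n : ℕ) (t : ℝ) (b : Fin n → ℝ) (i : Fin n) :
    gScale n t b i = t * (b i - 1 / n) + 1 / n := rfl

lemma gScale_gScale (n : ℕ) (s t : ℝ) (b : Fin n → ℝ) :
    gScale n s (gScale n t b) = gScale n (s * t) b := by
  ext i
  simp only [gScale_apply]
  ring

lemma gScale_one (n : ℕ) (b : Fin n → ℝ) : gScale n 1 b = b := by
  ext i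
  simp [gScale_apply]

lemma gScale_ne_gpt {n : ℕ} {t : ℝ} (ht : t ≠ 0) {b : Fin n → ℝ} (hb : b ≠ gpt n) :
    gScale n t b ≠ gpt n := by
  simpa [gScale, sub_eq_zero, ht] using hb

lemma sum_gpt {n : ℕ} [NeZero n] : ∑ i, gpt n i = 1 := by
  simp [gpt, NeZero.ne n]

lemma sum_gScale {n : ℕ} [NeZero n] (t : ℝ) {b : Fin n → ℝ} (hb : ∑ i, b i = 1) :
    ∑ i, gScale n t b i = 1 := by
  simp [gScale, Finset.sum_add_distrib, ← Finset.mul_sum, hb, sum_gpt]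

lemma iSup_gScale {n : ℕ} [NeZero n] {t : ℝ} (ht : 0 ≤ t) (b : Fin n → ℝ) :
    ⨆ i, gScale n t b i = t * ((⨆ i, b i) - 1 / n) + 1 / n := by
  apply le_antisymm
  · refine ciSup_le fun i => ?_
    rw [gScale_apply]
    gcongr
    exact le_ciSup (Set.finite_range b).bddAbove i
  · obtain ⟨i, hi⟩ := exists_eq_ciSup_of_finite (f := b)
    rw [← hi, ← gScale_apply]
    exact le_ciSup (Set.finite_range (gScale n t b)).bddAbove i

lemma iInf_gScale {n : ℕ} [NeZero n] {t : ℝ} (ht : 0 ≤ t) (b : Fin n → ℝ) :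
    ⨅ i, gScale n t b i = t * ((⨅ i, b i) - 1 / n) + 1 / n := by
  apply le_antisymm
  · obtain ⟨i, hi⟩ := exists_eq_ciInf_of_finite (f := b)
    rw [← hi, ← gScale_apply]
    exact ciInf_le (Set.finite_range (gScale n t b)).bddBelow i
  · refine le_ciInf fun i => ?_
    rw [gScale_apply]
    gcongr
    exact ciInf_le (Set.finite_range b).bddBelow i

lemma iSup_sub_iInf_gScale {n : ℕ} [NeZero n] {t : ℝ} (ht : 0 ≤ t) (b : Fin n → ℝ) :
    (⨆ i, gScale n t b i) - ⨅ i, gScale n t b i = t * ((⨆ i, b i) - ⨅ i, b i) := by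
  rw [iSup_gScale ht, iInf_gScale ht]
  ring

lemma one_sub_mul_iInf_gScale {n : ℕ} [NeZero n] {t : ℝ} (ht : 0 ≤ t) (b : Fin n → ℝ) :
    1 - (n : ℝ) * ⨅ i, gScale n t b i = t * (1 - (n : ℝ) * ⨅ i, b i) := by
  have hn : (n : ℝ) ≠ 0 := NeZero.ne _
  rw [iInf_gScale ht]
  field_simp
  ring

lemma iInf_lt_of_sum_eq_one {n : ℕ} [NeZero n] {b : Fin n → ℝ} (hb : ∑ i, b i = 1)
    (hg : b ≠ gpt n) : ⨅ i, b i < 1 / (n : ℝ) := by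
  by_contra! h
  have hle : ∀ i ∈ Finset.univ, gpt n i ≤ b i := fun i _ =>
    h.trans (ciInf_le (Set.finite_range b).bddBelow i)
  have := (Finset.sum_eq_sum_iff_of_le hle).1 (sum_gpt.trans hb.symm)
  exact hg (funext fun i => (this i (Finset.mem_univ i)).symm)

lemma le_iSup_of_sum_eq_one {n : ℕ} [NeZero n] {b : Fin n → ℝ} (hb : ∑ i, b i = 1) :
    1 / (n : ℝ) ≤ ⨆ i, b i := by
  by_contra! h
  have : ∑ i, b i < ∑ i, gpt n i :=
    Finset.sum_lt_sum_of_nonempty Finset.univ_nonempty fun i _ =>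
      (le_ciSup (Set.finite_range b).bddAbove i).trans_lt h
  rw [hb, sum_gpt] at this
  exact lt_irrefl _ this

lemma iSup_sub_iInf_pos {n : ℕ} [NeZero n] {b : Fin n → ℝ} (hb : ∑ i, b i = 1)
    (hg : b ≠ gpt n) : 0 < (⨆ i, b i) - ⨅ i, b i :=
  sub_pos.2 ((iInf_lt_of_sum_eq_one hb hg).trans_le (le_iSup_of_sum_eq_one hb))

lemma one_sub_mul_iInf_pos {n : ℕ} [NeZero n] {b : Fin n → ℝ} (hb : ∑ i, b i = 1)
    (hg : b ≠ gpt n) : 0 < 1 - (n : ℝ) * ⨅ i, b i := by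
  have h := iInf_lt_of_sum_eq_one hb hg
  rw [lt_div_iff₀' (Nat.cast_pos.2 (NeZero.pos n))] at h
  exact sub_pos.2 h

lemma mem_Pset_iff {n : ℕ} [NeZero n] {b : Fin n → ℝ} :
    b ∈ Pset n ↔ ∑ i, b i = 1 ∧ (⨆ i, b i) - ⨅ i, b i ≤ 1 := by
  have hn : (n : ℝ) ≠ 0 := NeZero.ne _
  constructor
  · rintro ⟨a, ha, rfl⟩
    constructor
    · simp [Psi0, uvec, Finset.sum_add_distrib, mul_div_cancel₀ _ hn]
    · obtain ⟨i, hi⟩ := exists_eq_ciSup_of_finite (f := Psi0 n a)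
      obtain ⟨j, hj⟩ := exists_eq_ciInf_of_finite (f := Psi0 n a)
      rw [← hi, ← hj]
      simp only [Psi0, uvec, Pi.add_apply, Pi.smul_apply, smul_eq_mul]
      linarith [(ha i).2, (ha j).1]
  · rintro ⟨hb, h⟩
    refine ⟨fun i => b i - ⨅ j, b j, fun i => ⟨?_, ?_⟩, ?_⟩
    · exact sub_nonneg.2 (ciInf_le (Set.finite_range b).bddBelow i)
    · linarith [le_ciSup (Set.finite_range b).bddAbove i]
    · ext i
      simp [Psi0, uvec, hb, hn]

lemma mem_Kset_iff {n : ℕ} [NeZero n] {b : Fin n → ℝ} :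
    b ∈ Kset n ↔ ∑ i, b i = 1 ∧ 1 - (n : ℝ) * ⨅ i, b i ≤ 1 := by
  have hn : (0 : ℝ) < n := Nat.cast_pos.2 (NeZero.pos n)
  rw [sub_le_self_iff, mul_nonneg_iff_of_pos_left hn]
  constructor
  · rintro ⟨hH, hb⟩
    exact ⟨hb, le_ciInf fun i => (hH i).1⟩
  · rintro ⟨hb, h⟩
    have h0 : ∀ i, 0 ≤ b i := fun i => h.trans (ciInf_le (Set.finite_range b).bddBelow i)
    exact ⟨fun i => ⟨h0 i, hb ▸ Finset.single_le_sum (fun j _ => h0 j) (Finset.mem_univ i)⟩, hb⟩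

lemma gpt_mem_Pset {n : ℕ} [NeZero n] : gpt n ∈ Pset n :=
  mem_Pset_iff.2 ⟨sum_gpt, by simp [gpt]⟩

lemma gpt_mem_Kset {n : ℕ} [NeZero n] : gpt n ∈ Kset n :=
  mem_Kset_iff.2 ⟨sum_gpt, by simp [gpt, NeZero.ne n]⟩

lemma psiMap_gpt (n : ℕ) : psiMap n (gpt n) = gpt n := if_pos rfl

lemma psiInv_gpt (n : ℕ) : psiInv n (gpt n) = gpt n := if_pos rfl

lemma psiMap_of_ne {n : ℕ} {b : Fin n → ℝ} (hg : b ≠ gpt n) :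
    psiMap n b = gScale n (((⨆ i, b i) - ⨅ i, b i) / (1 - (n : ℝ) * ⨅ i, b i)) b :=
  if_neg hg

lemma psiInv_of_ne {n : ℕ} {b : Fin n → ℝ} (hg : b ≠ gpt n) :
    psiInv n b = gScale n ((1 - (n : ℝ) * ⨅ i, b i) / ((⨆ i, b i) - ⨅ i, b i)) b :=
  if_neg hg

lemma psiMap_mem_Kset {n : ℕ} [NeZero n] {b : Fin n → ℝ} (hb : b ∈ Pset n) :
    psiMap n b ∈ Kset n := by
  by_cases hg : b = gpt n
  · rw [hg, psiMap_gpt]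
    exact gpt_mem_Kset
  obtain ⟨hs, h⟩ := mem_Pset_iff.1 hb
  have hR := iSup_sub_iInf_pos hs hg
  have hD := one_sub_mul_iInf_pos hs hg
  rw [psiMap_of_ne hg, mem_Kset_iff, one_sub_mul_iInf_gScale (div_pos hR hD).le,
    div_mul_cancel₀ _ hD.ne']
  exact ⟨sum_gScale _ hs, h⟩

lemma psiInv_mem_Pset {n : ℕ} [NeZero n] {b : Fin n → ℝ} (hb : b ∈ Kset n) :
    psiInv n b ∈ Pset n := by
  by_cases hg : b = gpt n
  · rw [hg, psiInv_gpt]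
    exact gpt_mem_Pset
  obtain ⟨hs, h⟩ := mem_Kset_iff.1 hb
  have hR := iSup_sub_iInf_pos hs hg
  have hD := one_sub_mul_iInf_pos hs hg
  rw [psiInv_of_ne hg, mem_Pset_iff, iSup_sub_iInf_gScale (div_pos hD hR).le,
    div_mul_cancel₀ _ hR.ne']
  exact ⟨sum_gScale _ hs, h⟩

lemma psiInv_psiMap {n : ℕ} [NeZero n] {b : Fin n → ℝ} (hs : ∑ i, b i = 1) :
    psiInv n (psiMap n b) = b := by
  by_cases hg : b = gpt n
  · rw [hg, psiMap_gpt, psiInv_gpt]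
  have hR := iSup_sub_iInf_pos hs hg
  have hD := one_sub_mul_iInf_pos hs hg
  have ht := div_pos hR hD
  rw [psiMap_of_ne hg, psiInv_of_ne (gScale_ne_gpt ht.ne' hg), one_sub_mul_iInf_gScale ht.le,
    iSup_sub_iInf_gScale ht.le, gScale_gScale, mul_div_mul_left _ _ ht.ne',
    div_mul_div_cancel₀ hR.ne', div_self hD.ne', gScale_one]

lemma psiMap_psiInv {n : ℕ} [NeZero n] {b : Fin n → ℝ} (hs : ∑ i, b i = 1) :
    psiMap n (psiInv n b) = b := by
  by_cases hg : b = gpt n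
  · rw [hg, psiInv_gpt, psiMap_gpt]
  have hR := iSup_sub_iInf_pos hs hg
  have hD := one_sub_mul_iInf_pos hs hg
  have ht := div_pos hD hR
  rw [psiInv_of_ne hg, psiMap_of_ne (gScale_ne_gpt ht.ne' hg), one_sub_mul_iInf_gScale ht.le,
    iSup_sub_iInf_gScale ht.le, gScale_gScale, mul_div_mul_left _ _ ht.ne',
    div_mul_div_cancel₀ hD.ne', div_self hR.ne', gScale_one]

/-- `ψ : P → K` is well defined and bijective, with inverse `ψ⁻¹ : K → P`. -/
theorem stmt14 (n : ℕ) (hn : 2 ≤ n) :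
    (∀ b ∈ Pset n, psiMap n b ∈ Kset n) ∧
    Set.BijOn (psiMap n) (Pset n) (Kset n) ∧
    (∀ b ∈ Pset n, psiInv n (psiMap n b) = b) ∧
    (∀ b' ∈ Kset n, psiInv n b' ∈ Pset n ∧ psiMap n (psiInv n b') = b') := by
  have : NeZero n := ⟨by omega⟩
  have hinv : Set.InvOn (psiInv n) (psiMap n) (Pset n) (Kset n) :=
    ⟨fun _ hb => psiInv_psiMap (mem_Pset_iff.1 hb).1,
      fun _ hb => psiMap_psiInv (mem_Kset_iff.1 hb).1⟩
  have hmaps : Set.MapsTo (psiMap n) (Pset n) (Kset n) := fun _ => psiMap_mem_Kset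
  have hmaps' : Set.MapsTo (psiInv n) (Kset n) (Pset n) := fun _ => psiInv_mem_Pset
  exact ⟨hmaps, hinv.bijOn hmaps hmaps', hinv.1, fun _ hb => ⟨hmaps' hb, hinv.2 hb⟩⟩
end
end

section
/- Fix an integer n ≥ 2. The functor F[n] : Covering[n] → Partition[n]_{P̄}, defined on objects by sending a covering (X,(Aᵢ)_{i∈[n]}) to (X,(Bᵢ)_{i∈[n]}) where Bᵢ(x) = (1/(n−1))·Aᵢ(x) − (1/(n(n−1)))·Σ_{j∈[n]} Aⱼ(x) + 1/n, and acting as the identity on morphisms (f,ρ), and the functor G[n] : Partition[n]_{P̄} → Covering[n], defined on objects by sending (X,(Bᵢ)_{i∈[n]}) to (X,(Aᵢ)_{i∈[n]}) where Aᵢ(x) = (n−1)·(Bᵢ(x) − max_{j∈[n]} Bⱼ(x)) + 1, and acting as the identity on morphisms, are well defined and fully faithful and are mutually inverse; hence Covering[n] and Partition[n]_{P̄} are isomorphic categories. -/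
open CategoryTheory

noncomputable section

/-- The map `Ψ(a) = (1/(n−1))·a − ((a₁+⋯+aₙ)/(n(n−1)))·u + (1/n)·u`. -/
def PsiMap (n : ℕ) (a : Fin n → ℝ) : Fin n → ℝ :=
  (1 / ((n : ℝ) - 1)) • a - ((∑ i, a i) / ((n : ℝ) * ((n : ℝ) - 1))) • uvec n
    + (1 / (n : ℝ)) • uvec n

/-- `P̄ = Ψ(F) ⊆ K`. -/
def Pbar (n : ℕ) : Set (Fin n → ℝ) := PsiMap n '' Fset n

/-- An object of `Covering[n]`: a set `X` with fuzzy sets `Aᵢ : X → [0,1]`, `i ∈ [n]`,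
such that every `x` has some `i` with `Aᵢ(x) = 1`. -/
structure CoveringN (n : ℕ) where
  X : Type
  A : Fin n → X → ℝ
  mem01 : ∀ i x, 0 ≤ A i x ∧ A i x ≤ 1
  cover : ∀ x, ∃ i, A i x = 1

/-- A morphism in `Covering[n]`: a pair `(f, ρ)` with `Aᵢ(x) ≤ A'_{ρ(i)}(f(x))`. -/
@[ext]
structure CovNHom {n : ℕ} (C D : CoveringN n) where
  f : C.X → D.X
  ρ : Fin n → Fin n
  le : ∀ x i, C.A i x ≤ D.A (ρ i) (f x)

instance (n : ℕ) : Category (CoveringN n) where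
  Hom := CovNHom
  id C := ⟨id, id, fun _ _ => le_refl _⟩
  comp φ ψ := ⟨CovNHom.f ψ ∘ CovNHom.f φ, CovNHom.ρ ψ ∘ CovNHom.ρ φ,
    fun x i => (CovNHom.le φ x i).trans (CovNHom.le ψ (CovNHom.f φ x) (CovNHom.ρ φ i))⟩

/-- An object of `Partition[n]_{P̄}`: a set `X` with fuzzy sets `Bᵢ : X → [0,1]`,
`i ∈ [n]`, with `Σᵢ Bᵢ(x) = 1` and `(B₁(x),…,Bₙ(x)) ∈ P̄` for all `x`. -/
structure PartitionNP (n : ℕ) where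
  X : Type
  B : Fin n → X → ℝ
  mem01 : ∀ i x, 0 ≤ B i x ∧ B i x ≤ 1
  sum_one : ∀ x, ∑ i, B i x = 1
  memP : ∀ x, (fun i => B i x) ∈ Pbar n

/-- A morphism in `Partition[n]_{P̄}`: a pair `(f, ρ)` with
`Bᵢ(x) − maxᵢ Bᵢ(x) ≤ B'_{ρ(i)}(f(x)) − maxⱼ B'ⱼ(f(x))`. -/
@[ext]
structure ParNHom {n : ℕ} (P Q : PartitionNP n) where
  f : P.X → Q.X
  ρ : Fin n → Fin n
  cond : ∀ x i, P.B i x - (⨆ j, P.B j x) ≤ Q.B (ρ i) (f x) - ⨆ j, Q.B j (f x)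

instance (n : ℕ) : Category (PartitionNP n) where
  Hom := ParNHom
  id P := ⟨id, id, fun _ _ => le_refl _⟩
  comp φ ψ := ⟨ParNHom.f ψ ∘ ParNHom.f φ, ParNHom.ρ ψ ∘ ParNHom.ρ φ,
    fun x i => (ParNHom.cond φ x i).trans (ParNHom.cond ψ (ParNHom.f φ x) (ParNHom.ρ φ i))⟩

theorem PsiMap_apply (n : ℕ) (a : Fin n → ℝ) (i : Fin n) :
    PsiMap n a i = (1 / ((n : ℝ) - 1)) * a i - (1 / ((n : ℝ) * ((n : ℝ) - 1))) * ∑ j, a j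
      + 1 / (n : ℝ) := by
  simp only [PsiMap, uvec, Pi.add_apply, Pi.sub_apply, Pi.smul_apply, smul_eq_mul]
  ring

theorem PsiMap_mem_Icc {n : ℕ} (hn : 2 ≤ n) {a : Fin n → ℝ} (ha : a ∈ Hset n) (i : Fin n) :
    0 ≤ PsiMap n a i ∧ PsiMap n a i ≤ 1 := by
  have h2 : (2 : ℝ) ≤ n := by exact_mod_cast hn
  have h1 : (0 : ℝ) < (n : ℝ) - 1 := by linarith
  have h0 : (0 : ℝ) < n := by linarith
  have hS : ∑ j, a j ≤ a i + ((n : ℝ) - 1) := by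
    rw [← Finset.add_sum_erase _ _ (Finset.mem_univ i)]
    have := Finset.sum_le_card_nsmul (Finset.univ.erase i) a 1 (fun j _ => (ha j).2)
    rw [Finset.card_erase_of_mem (Finset.mem_univ i), Finset.card_univ, Fintype.card_fin,
      nsmul_eq_mul, Nat.cast_sub (by omega)] at this
    push_cast at this
    linarith
  have hS' : a i ≤ ∑ j, a j :=
    Finset.single_le_sum (fun j _ => (ha j).1) (Finset.mem_univ i)
  have key : PsiMap n a i = (n * a i - ∑ j, a j + (n - 1)) / (n * ((n : ℝ) - 1)) := by
    rw [PsiMap_apply]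
    field_simp
  obtain ⟨hi0, hi1⟩ := ha i
  rw [key]
  constructor
  · apply div_nonneg _ (by positivity)
    nlinarith
  · rw [div_le_one (by positivity)]
    nlinarith

theorem sum_PsiMap {n : ℕ} (hn : 2 ≤ n) (a : Fin n → ℝ) : ∑ i, PsiMap n a i = 1 := by
  have h2 : (2 : ℝ) ≤ n := by exact_mod_cast hn
  have h1 : (n : ℝ) - 1 ≠ 0 := by linarith
  have h0 : (n : ℝ) ≠ 0 := by linarith
  simp only [PsiMap_apply, Finset.sum_add_distrib, Finset.sum_sub_distrib, ← Finset.mul_sum,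
    Finset.sum_const, Finset.card_univ, Fintype.card_fin, nsmul_eq_mul]
  field_simp
  ring

theorem PsiMap_sub_iSup {n : ℕ} (hn : 2 ≤ n) {a : Fin n → ℝ} (ha : a ∈ Fset n) (i : Fin n) :
    ((n : ℝ) - 1) * (PsiMap n a i - ⨆ j, PsiMap n a j) + 1 = a i := by
  have h2 : (2 : ℝ) ≤ n := by exact_mod_cast hn
  have h1 : (0 : ℝ) < (n : ℝ) - 1 := by linarith
  obtain ⟨hH, k, hk⟩ := ha
  have : Nonempty (Fin n) := ⟨i⟩
  have hsup : ⨆ j, PsiMap n a j = PsiMap n a k := by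
    refine le_antisymm (ciSup_le fun j => ?_) (le_ciSup (Set.finite_range _).bddAbove k)
    have : a j ≤ a k := hk ▸ (hH j).2
    simp only [PsiMap_apply]
    gcongr
  rw [hsup, PsiMap_apply, PsiMap_apply, hk]
  field_simp
  ring

theorem CoveringN.mem_Fset {n : ℕ} (C : CoveringN n) (x : C.X) : (fun i => C.A i x) ∈ Fset n :=
  ⟨fun i => C.mem01 i x, C.cover x⟩

/-- The partition `(X, (Bᵢ))` with `B = Ψ(A)` attached to a covering `(X, (Aᵢ))`. -/
def CoveringN.toPartition {n : ℕ} (hn : 2 ≤ n) (C : CoveringN n) : PartitionNP n where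
  X := C.X
  B i x := PsiMap n (fun j => C.A j x) i
  mem01 i x := PsiMap_mem_Icc hn (C.mem_Fset x).1 i
  sum_one _ := sum_PsiMap hn _
  memP x := ⟨_, C.mem_Fset x, rfl⟩

/-- The fuzzy sets `(n−1)·(Bᵢ − maxⱼ Bⱼ) + 1` attached to a partition. -/
def PartitionNP.coverFun {n : ℕ} (P : PartitionNP n) (i : Fin n) (x : P.X) : ℝ :=
  ((n : ℝ) - 1) * (P.B i x - ⨆ j, P.B j x) + 1

theorem PartitionNP.coverFun_mem_Fset {n : ℕ} (hn : 2 ≤ n) (P : PartitionNP n) (x : P.X) :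
    (fun i => P.coverFun i x) ∈ Fset n ∧ PsiMap n (fun i => P.coverFun i x) = fun i => P.B i x := by
  obtain ⟨a, ha, hB⟩ := P.memP x
  have hB' : ∀ i, P.B i x = PsiMap n a i := fun i => (congrFun hB i).symm
  have h : (fun i => P.coverFun i x) = a := by
    funext i
    simp only [PartitionNP.coverFun, hB']
    exact PsiMap_sub_iSup hn ha i
  rw [h]
  exact ⟨ha, hB⟩

/-- The covering attached to a partition. -/
def PartitionNP.toCovering {n : ℕ} (hn : 2 ≤ n) (P : PartitionNP n) : CoveringN n where
  X := P.X
  A := P.coverFun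
  mem01 i x := (P.coverFun_mem_Fset hn x).1.1 i
  cover x := (P.coverFun_mem_Fset hn x).1.2

theorem CoveringN.ext_fun {n : ℕ} {X : Type} {A A' : Fin n → X → ℝ} (h : A = A')
    (m : ∀ i x, 0 ≤ A i x ∧ A i x ≤ 1) (c : ∀ x, ∃ i, A i x = 1)
    (m' : ∀ i x, 0 ≤ A' i x ∧ A' i x ≤ 1) (c' : ∀ x, ∃ i, A' i x = 1) :
    (⟨X, A, m, c⟩ : CoveringN n) = ⟨X, A', m', c'⟩ := by
  subst h
  rfl

theorem PartitionNP.ext_fun {n : ℕ} {X : Type} {B B' : Fin n → X → ℝ} (h : B = B')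
    (m : ∀ i x, 0 ≤ B i x ∧ B i x ≤ 1) (s : ∀ x, ∑ i, B i x = 1)
    (p : ∀ x, (fun i => B i x) ∈ Pbar n)
    (m' : ∀ i x, 0 ≤ B' i x ∧ B' i x ≤ 1) (s' : ∀ x, ∑ i, B' i x = 1)
    (p' : ∀ x, (fun i => B' i x) ∈ Pbar n) :
    (⟨X, B, m, s, p⟩ : PartitionNP n) = ⟨X, B', m', s', p'⟩ := by
  subst h
  rfl

theorem CoveringN.toCovering_toPartition {n : ℕ} (hn : 2 ≤ n) (C : CoveringN n) :
    (C.toPartition hn).toCovering hn = C := by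
  refine CoveringN.ext_fun ?_ _ _ C.mem01 C.cover
  funext i x
  exact PsiMap_sub_iSup hn (C.mem_Fset x) i

theorem PartitionNP.toPartition_toCovering {n : ℕ} (hn : 2 ≤ n) (P : PartitionNP n) :
    (P.toCovering hn).toPartition hn = P := by
  refine PartitionNP.ext_fun ?_ _ _ _ P.mem01 P.sum_one P.memP
  funext i x
  exact congrFun (P.coverFun_mem_Fset hn x).2 i

theorem CovNHom.hext {n : ℕ} {C C' D D' : CoveringN n} (hC : C = C') (hD : D = D')
    {φ : CovNHom C D} {ψ : CovNHom C' D'} (hf : HEq φ.f ψ.f) (hρ : φ.ρ = ψ.ρ) : HEq φ ψ := by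
  subst hC hD
  exact heq_of_eq (CovNHom.ext (eq_of_heq hf) hρ)

theorem ParNHom.hext {n : ℕ} {P P' Q Q' : PartitionNP n} (hP : P = P') (hQ : Q = Q')
    {φ : ParNHom P Q} {ψ : ParNHom P' Q'} (hf : HEq φ.f ψ.f) (hρ : φ.ρ = ψ.ρ) : HEq φ ψ := by
  subst hP hQ
  exact heq_of_eq (ParNHom.ext (eq_of_heq hf) hρ)

theorem PartitionNP.coverFun_le_iff {n : ℕ} (hn : 2 ≤ n) (P Q : PartitionNP n) (i j : Fin n)
    (x : P.X) (y : Q.X) :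
    P.coverFun i x ≤ Q.coverFun j y ↔
      P.B i x - (⨆ k, P.B k x) ≤ Q.B j y - ⨆ k, Q.B k y := by
  have h2 : (2 : ℝ) ≤ n := by exact_mod_cast hn
  have h1 : (0 : ℝ) < (n : ℝ) - 1 := by linarith
  rw [PartitionNP.coverFun, PartitionNP.coverFun, add_le_add_iff_right, mul_le_mul_iff_right₀ h1]

theorem CoveringN.coverFun_toPartition {n : ℕ} (hn : 2 ≤ n) (C : CoveringN n) (i : Fin n)
    (x : C.X) : (C.toPartition hn).coverFun i x = C.A i x :=
  PsiMap_sub_iSup hn (C.mem_Fset x) i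

theorem CoveringN.le_iff {n : ℕ} (hn : 2 ≤ n) (C D : CoveringN n) (i j : Fin n)
    (x : C.X) (y : D.X) :
    C.A i x ≤ D.A j y ↔
      (C.toPartition hn).B i x - (⨆ k, (C.toPartition hn).B k x) ≤
        (D.toPartition hn).B j y - ⨆ k, (D.toPartition hn).B k y := by
  rw [← C.coverFun_toPartition hn, ← D.coverFun_toPartition hn]
  exact (C.toPartition hn).coverFun_le_iff hn (D.toPartition hn) i j x y

/-- The functor `F[n] : Covering[n] ⥤ Partition[n]_{P̄}`. -/
def coveringToPartition {n : ℕ} (hn : 2 ≤ n) : CoveringN n ⥤ PartitionNP n where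
  obj C := C.toPartition hn
  map {C D} φ := ParNHom.mk (P := C.toPartition hn) (Q := D.toPartition hn) (CovNHom.f φ)
    (CovNHom.ρ φ) fun x i => (C.le_iff hn D i _ x _).1 (CovNHom.le φ x i)

/-- The functor `G[n] : Partition[n]_{P̄} ⥤ Covering[n]`. -/
def partitionToCovering {n : ℕ} (hn : 2 ≤ n) : PartitionNP n ⥤ CoveringN n where
  obj P := P.toCovering hn
  map {P Q} φ := CovNHom.mk (C := P.toCovering hn) (D := Q.toCovering hn) (ParNHom.f φ)
    (ParNHom.ρ φ) fun x i => (P.coverFun_le_iff hn Q i _ x _).2 (ParNHom.cond φ x i)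

instance {n : ℕ} (hn : 2 ≤ n) : (coveringToPartition hn).Full where
  map_surjective {C D} ψ :=
    ⟨CovNHom.mk (C := C) (D := D) (ParNHom.f ψ) (ParNHom.ρ ψ)
      fun x i => (C.le_iff hn D i _ x _).2 (ParNHom.cond ψ x i), rfl⟩

instance {n : ℕ} (hn : 2 ≤ n) : (coveringToPartition hn).Faithful where
  map_injective h := CovNHom.ext (congrArg ParNHom.f h) (congrArg ParNHom.ρ h)

instance {n : ℕ} (hn : 2 ≤ n) : (partitionToCovering hn).Full where
  map_surjective {P Q} ψ :=
    ⟨ParNHom.mk (P := P) (Q := Q) (CovNHom.f ψ) (CovNHom.ρ ψ)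
      fun x i => (P.coverFun_le_iff hn Q i _ x _).1 (CovNHom.le ψ x i), rfl⟩

instance {n : ℕ} (hn : 2 ≤ n) : (partitionToCovering hn).Faithful where
  map_injective h := ParNHom.ext (congrArg CovNHom.f h) (congrArg CovNHom.ρ h)

theorem coveringToPartition_comp {n : ℕ} (hn : 2 ≤ n) :
    coveringToPartition hn ⋙ partitionToCovering hn = 𝟭 (CoveringN n) :=
  Functor.hext (fun C => C.toCovering_toPartition hn) fun C D _ =>
    CovNHom.hext (C.toCovering_toPartition hn) (D.toCovering_toPartition hn) HEq.rfl rfl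

theorem partitionToCovering_comp {n : ℕ} (hn : 2 ≤ n) :
    partitionToCovering hn ⋙ coveringToPartition hn = 𝟭 (PartitionNP n) :=
  Functor.hext (fun P => P.toPartition_toCovering hn) fun P Q _ =>
    ParNHom.hext (P.toPartition_toCovering hn) (Q.toPartition_toCovering hn) HEq.rfl rfl

/-- The functors `F[n] : Covering[n] ⥤ Partition[n]_{P̄}` (with
`Bᵢ(x) = (1/(n−1))·Aᵢ(x) − (1/(n(n−1)))·Σⱼ Aⱼ(x) + 1/n`, identity on morphisms) and
`G[n] : Partition[n]_{P̄} ⥤ Covering[n]` (with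
`Aᵢ(x) = (n−1)·(Bᵢ(x) − maxⱼ Bⱼ(x)) + 1`, identity on morphisms) are well defined,
fully faithful and mutually inverse; hence the two categories are isomorphic. -/
theorem stmt19 (n : ℕ) (hn : 2 ≤ n) :
    ∃ (F : CoveringN n ⥤ PartitionNP n) (G : PartitionNP n ⥤ CoveringN n),
      (∀ C : CoveringN n, (F.obj C).X = C.X ∧
        HEq (F.obj C).B (fun (i : Fin n) (x : C.X) =>
          (1 / ((n : ℝ) - 1)) * C.A i x - (1 / ((n : ℝ) * ((n : ℝ) - 1))) * ∑ j, C.A j x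
            + 1 / (n : ℝ))) ∧
      (∀ (C D : CoveringN n) (φ : C ⟶ D),
        HEq (ParNHom.f (F.map φ)) (CovNHom.f φ) ∧ ParNHom.ρ (F.map φ) = CovNHom.ρ φ) ∧
      (∀ P : PartitionNP n, (G.obj P).X = P.X ∧
        HEq (G.obj P).A (fun (i : Fin n) (x : P.X) =>
          ((n : ℝ) - 1) * (P.B i x - ⨆ j, P.B j x) + 1)) ∧
      (∀ (P Q : PartitionNP n) (φ : P ⟶ Q),
        HEq (CovNHom.f (G.map φ)) (ParNHom.f φ) ∧ CovNHom.ρ (G.map φ) = ParNHom.ρ φ) ∧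
      F.Full ∧ F.Faithful ∧ G.Full ∧ G.Faithful ∧
      F ⋙ G = 𝟭 (CoveringN n) ∧ G ⋙ F = 𝟭 (PartitionNP n) := by
  refine ⟨coveringToPartition hn, partitionToCovering hn, fun C => ⟨rfl, heq_of_eq ?_⟩,
    fun C D φ => ⟨HEq.rfl, rfl⟩, fun P => ⟨rfl, HEq.rfl⟩, fun P Q φ => ⟨HEq.rfl, rfl⟩,
    inferInstance, inferInstance, inferInstance, inferInstance,
    coveringToPartition_comp hn, partitionToCovering_comp hn⟩
  funext i x
  exact PsiMap_apply n _ i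
end
end
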